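/- For all p, q ∈ {1,…,n} with p ≠ q and every η ∈ W = ker V*, one has ‖η − P_{W̃_p} η‖² + ‖U_p η − P_{W̃_q}(U_p η)‖² = ‖(∏_{i≠p,q} V_i*) η‖², and consequently ‖η − P_{W̃_p} η‖² + ‖U_p η − P_{W̃_q}(U_p η)‖² = ‖η − P_{W̃_q} η‖² + ‖U_q η − P_{W̃_p}(U_q η)‖² ≤ ‖η‖². (This is the quadratic-form formulation, over the complex scalars, of the operator identity P⊥_{W̃_p} + U_p* P⊥_{W̃_q} U_p = P⊥_{W̃_q} + U_q* P⊥_{W̃_p} U_q ≤ I_W.) -/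

import Mathlib

open ContinuousLinearMap Filter Finset

/-- Product of the commuting operators `V i` over a finite index set `s`. -/
noncomputable def opProd {H : Type*} [NormedAddCommGroup H] [InnerProductSpace ℂ H]
    {n : ℕ} (V : Fin n → H →L[ℂ] H) (hcomm : ∀ i j, Commute (V i) (V j))
    (s : Finset (Fin n)) : H →L[ℂ] H :=
  s.noncommProd V fun a _ b _ _ => hcomm a b

/-- The wandering subspace `ker ((∏_{i ∈ s} V i)^*)`. -/
noncomputable def wSub {H : Type*} [NormedAddCommGroup H] [InnerProductSpace ℂ H] [CompleteSpace H]
    {n : ℕ} (V : Fin n → H →L[ℂ] H) (hcomm : ∀ i j, Commute (V i) (V j))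
    (s : Finset (Fin n)) : Submodule ℂ H :=
  LinearMap.ker (ContinuousLinearMap.adjoint (opProd V hcomm s)).toLinearMap

/-- The orthogonal projection of `H` onto `wSub V hcomm s`, as an operator on `H`. -/
noncomputable def wProj {H : Type*} [NormedAddCommGroup H] [InnerProductSpace ℂ H] [CompleteSpace H]
    {n : ℕ} (V : Fin n → H →L[ℂ] H) (hcomm : ∀ i j, Commute (V i) (V j))
    (s : Finset (Fin n)) : H →L[ℂ] H :=
  haveI : CompleteSpace (wSub V hcomm s) :=
    (ContinuousLinearMap.isClosed_ker _).completeSpace_coe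
  (wSub V hcomm s).subtypeL ∘L Submodule.orthogonalProjectionOnto (wSub V hcomm s)

/-- The operator `U_i = P_W ∘ V_i + Ṽ_i^*`, which restricts to a unitary on `W`. -/
noncomputable def Uop {H : Type*} [NormedAddCommGroup H] [InnerProductSpace ℂ H] [CompleteSpace H]
    {n : ℕ} (V : Fin n → H →L[ℂ] H) (hcomm : ∀ i j, Commute (V i) (V j))
    (i : Fin n) : H →L[ℂ] H :=
  (wProj V hcomm Finset.univ) ∘L V i
    + ContinuousLinearMap.adjoint (opProd V hcomm (Finset.univ.erase i))

section OpProd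

variable {H : Type*} [NormedAddCommGroup H] [InnerProductSpace ℂ H] {n : ℕ}
  (V : Fin n → H →L[ℂ] H) (hcomm : ∀ i j, Commute (V i) (V j)) {s : Finset (Fin n)} {i : Fin n}

theorem mul_opProd_erase (hi : i ∈ s) :
    V i * opProd V hcomm (s.erase i) = opProd V hcomm s :=
  s.mul_noncommProd_erase hi V _

theorem opProd_erase_mul (hi : i ∈ s) :
    opProd V hcomm (s.erase i) * V i = opProd V hcomm s :=
  s.noncommProd_erase_mul hi V _

theorem norm_opProd_apply (hiso : ∀ i x, ‖V i x‖ = ‖x‖) (s : Finset (Fin n)) (x : H) :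
    ‖opProd V hcomm s x‖ = ‖x‖ := by
  refine s.noncommProd_induction V _ (fun A : H →L[ℂ] H => ∀ x, ‖A x‖ = ‖x‖)
    (fun A B hA hB x => ?_) (fun x => rfl) (fun i _ => hiso i) x
  rw [mul_apply_eq_comp, hA, hB]

end OpProd

section Isometry

variable {H : Type*} [NormedAddCommGroup H] [InnerProductSpace ℂ H] [CompleteSpace H]

theorem adjoint_apply_self_of_norm_map {A : H →L[ℂ] H} (hA : ∀ x, ‖A x‖ = ‖x‖) (x : H) :
    adjoint A (A x) = x :=
  DFunLike.congr_fun ((ContinuousLinearMap.norm_map_iff_adjoint_comp_self A).1 hA) x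

theorem adjoint_mul_apply (A B : H →L[ℂ] H) (x : H) :
    adjoint (A * B) x = adjoint B (adjoint A x) := by
  rw [ContinuousLinearMap.mul_def, ContinuousLinearMap.adjoint_comp,
    ContinuousLinearMap.comp_apply]

theorem norm_sub_apply_adjoint_sq {A : H →L[ℂ] H} (hA : ∀ x, ‖A x‖ = ‖x‖) (x : H) :
    ‖x - A (adjoint A x)‖ ^ 2 = ‖x‖ ^ 2 - ‖adjoint A x‖ ^ 2 := by
  rw [@norm_sub_sq ℂ, ← ContinuousLinearMap.adjoint_inner_left, hA, inner_self_eq_norm_sq]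
  ring

theorem norm_adjoint_apply_sq_le {A : H →L[ℂ] H} (hA : ∀ x, ‖A x‖ = ‖x‖) (x : H) :
    ‖adjoint A x‖ ^ 2 ≤ ‖x‖ ^ 2 := by
  linarith [norm_sub_apply_adjoint_sq hA x, sq_nonneg ‖x - A (adjoint A x)‖]

variable {n : ℕ} (V : Fin n → H →L[ℂ] H) (hcomm : ∀ i j, Commute (V i) (V j))

theorem wProj_apply (hiso : ∀ i x, ‖V i x‖ = ‖x‖) (s : Finset (Fin n)) (x : H) :
    wProj V hcomm s x = x - opProd V hcomm s (adjoint (opProd V hcomm s) x) := by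
  have : CompleteSpace (wSub V hcomm s) :=
    (ContinuousLinearMap.isClosed_ker _).completeSpace_coe
  have hA := adjoint_apply_self_of_norm_map (norm_opProd_apply V hcomm hiso s)
  refine Submodule.eq_starProjection_of_mem_of_inner_eq_zero ?_ fun w hw => ?_
  · simp [wSub, hA]
  · have hw' : adjoint (opProd V hcomm s) w = 0 := hw
    rw [sub_sub_cancel, ← ContinuousLinearMap.adjoint_inner_right, hw', inner_zero_right]

theorem norm_sub_wProj_apply (hiso : ∀ i x, ‖V i x‖ = ‖x‖) (s : Finset (Fin n)) (x : H) :
    ‖x - wProj V hcomm s x‖ = ‖adjoint (opProd V hcomm s) x‖ := by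
  rw [wProj_apply V hcomm hiso, sub_sub_cancel, norm_opProd_apply V hcomm hiso]

theorem adjoint_opProd_erase_Uop (hiso : ∀ i x, ‖V i x‖ = ‖x‖) {p q : Fin n} (hpq : p ≠ q)
    {η : H} (hη : η ∈ wSub V hcomm univ) :
    adjoint (opProd V hcomm (univ.erase q)) (Uop V hcomm p η)
      = adjoint (opProd V hcomm ((univ.erase p).erase q)) η
        - V q (adjoint (V q) (adjoint (opProd V hcomm ((univ.erase p).erase q)) η)) := by
  have hη' : adjoint (opProd V hcomm univ) η = 0 := hη
  have hp : opProd V hcomm univ = V p * opProd V hcomm (univ.erase p) :=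
    (mul_opProd_erase V hcomm (mem_univ p)).symm
  have hq : opProd V hcomm univ = opProd V hcomm (univ.erase q) * V q :=
    (opProd_erase_mul V hcomm (mem_univ q)).symm
  have hpq' : opProd V hcomm (univ.erase p)
      = opProd V hcomm ((univ.erase p).erase q) * V q :=
    (opProd_erase_mul V hcomm (by simp [hpq.symm])).symm
  have hqp : opProd V hcomm (univ.erase q)
      = V p * opProd V hcomm ((univ.erase p).erase q) := by
    rw [erase_right_comm]
    exact (mul_opProd_erase V hcomm (by simp [hpq])).symm
  have hVp := adjoint_apply_self_of_norm_map (hiso p)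
  have hBq := adjoint_apply_self_of_norm_map (norm_opProd_apply V hcomm hiso (univ.erase q))
  have hVVp : adjoint (opProd V hcomm univ) (V p η)
      = adjoint (opProd V hcomm (univ.erase p)) η := by
    rw [hp, adjoint_mul_apply, hVp]
  have hzero : adjoint (opProd V hcomm (univ.erase q))
      (adjoint (opProd V hcomm (univ.erase p)) η) = 0 := by
    have h : opProd V hcomm (univ.erase p) * opProd V hcomm (univ.erase q)
        = opProd V hcomm univ * opProd V hcomm ((univ.erase p).erase q) := by
      rw [hqp, ← mul_assoc, opProd_erase_mul V hcomm (mem_univ p)]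
    rw [← adjoint_mul_apply, h, adjoint_mul_apply, hη', map_zero]
  have hV : adjoint (opProd V hcomm (univ.erase q))
      (opProd V hcomm univ (adjoint (opProd V hcomm (univ.erase p)) η))
      = V q (adjoint (opProd V hcomm (univ.erase p)) η) := by
    rw [hq, mul_apply_eq_comp, hBq]
  have hR : adjoint (opProd V hcomm (univ.erase q)) (V p η)
      = adjoint (opProd V hcomm ((univ.erase p).erase q)) η := by
    rw [hqp, adjoint_mul_apply, hVp]
  rw [Uop, add_apply, ContinuousLinearMap.comp_apply,
    wProj_apply V hcomm hiso, hVVp, map_add, map_sub, hzero, hV, hR, add_zero, hpq',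
    adjoint_mul_apply]

theorem norm_sub_wProj_sq_add_norm_Uop_sub_wProj_sq (hiso : ∀ i x, ‖V i x‖ = ‖x‖)
    {p q : Fin n} (hpq : p ≠ q) {η : H} (hη : η ∈ wSub V hcomm univ) :
    ‖η - wProj V hcomm (univ.erase p) η‖ ^ 2
        + ‖Uop V hcomm p η - wProj V hcomm (univ.erase q) (Uop V hcomm p η)‖ ^ 2
      = ‖adjoint (opProd V hcomm ((univ.erase p).erase q)) η‖ ^ 2 := by
  rw [norm_sub_wProj_apply V hcomm hiso, norm_sub_wProj_apply V hcomm hiso,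
    adjoint_opProd_erase_Uop V hcomm hiso hpq hη, norm_sub_apply_adjoint_sq (hiso q),
    ← adjoint_mul_apply, opProd_erase_mul V hcomm (by simp [hpq.symm])]
  ring

end Isometry

/-- For `p ≠ q` and `η ∈ W`:
`‖η − P_{W̃_p} η‖² + ‖U_p η − P_{W̃_q}(U_p η)‖² = ‖(∏_{i≠p,q} V_i^*) η‖²`, and this common
quantity is symmetric in `p, q` and is at most `‖η‖²`. -/
theorem stmt8 {H : Type*} [NormedAddCommGroup H] [InnerProductSpace ℂ H] [CompleteSpace H]
    {n : ℕ} (hn : 2 ≤ n) (V : Fin n → H →L[ℂ] H)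
    (hiso : ∀ i x, ‖V i x‖ = ‖x‖) (hcomm : ∀ i j, Commute (V i) (V j))
    (hshift : ∀ x : H,
      Tendsto (fun m : ℕ => ((ContinuousLinearMap.adjoint (opProd V hcomm Finset.univ)) ^ m) x)
        atTop (nhds 0))
    (p q : Fin n) (hpq : p ≠ q) (η : H) (hη : η ∈ wSub V hcomm Finset.univ) :
    (‖η - wProj V hcomm (Finset.univ.erase p) η‖ ^ 2
        + ‖Uop V hcomm p η - wProj V hcomm (Finset.univ.erase q) (Uop V hcomm p η)‖ ^ 2
      = ‖ContinuousLinearMap.adjoint (opProd V hcomm ((Finset.univ.erase p).erase q)) η‖ ^ 2) ∧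
    (‖η - wProj V hcomm (Finset.univ.erase p) η‖ ^ 2
        + ‖Uop V hcomm p η - wProj V hcomm (Finset.univ.erase q) (Uop V hcomm p η)‖ ^ 2
      = ‖η - wProj V hcomm (Finset.univ.erase q) η‖ ^ 2
        + ‖Uop V hcomm q η - wProj V hcomm (Finset.univ.erase p) (Uop V hcomm q η)‖ ^ 2) ∧
    ‖η - wProj V hcomm (Finset.univ.erase p) η‖ ^ 2
        + ‖Uop V hcomm p η - wProj V hcomm (Finset.univ.erase q) (Uop V hcomm p η)‖ ^ 2
      ≤ ‖η‖ ^ 2 := by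
  have h := norm_sub_wProj_sq_add_norm_Uop_sub_wProj_sq V hcomm hiso hpq hη
  refine ⟨h, ?_, ?_⟩
  · rw [h, norm_sub_wProj_sq_add_norm_Uop_sub_wProj_sq V hcomm hiso hpq.symm hη,
      erase_right_comm]
  · rw [h]
    exact norm_adjoint_apply_sq_le (norm_opProd_apply V hcomm hiso _) η
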